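/- arXiv:1012.1301 — 4 statements merged into one kernel-verified Lean document; each statement's English description precedes it below -/
import Mathlib

section
/- Let Σ be a fan in ℝ^d all of whose cones are generated by lattice vectors, whose set of rays Σ(1) spans ℝ^d, and choose for each ray ρ ∈ Σ(1) a nonzero lattice vector b_ρ ∈ ρ ∩ ℤ^d. Fix a cone σ ∈ Σ. Let P = {m ∈ ℤ^d : ⟨m, x⟩ ≥ 0 for all x ∈ σ} (an additive submonoid of ℤ^d) and let A = ℂ[P] be its monoid algebra, with ℂ-basis the monomials χ^m for m ∈ P. Let S_σ be the monoid algebra over ℂ of the monoid ℕ^{σ(1)} × ℤ^{Σ(1)∖σ(1)}, i.e. the ring of polynomials in the variables x_ρ for ρ ∈ σ(1) and Laurent polynomials in the variables x_ρ for ρ ∈ Σ(1)∖σ(1). Let φ : A → S_σ be the ℂ-algebra homomorphism defined on monomials by χ^m ↦ ∏_{ρ∈Σ(1)} x_ρ^{⟨m, b_ρ⟩} (the exponents ⟨m, b_ρ⟩ for ρ ∈ σ(1) are nonnegative since m ∈ P). Then the preimage under φ of the ideal of S_σ generated by {x_ρ : ρ ∈ σ(1)} is the ideal of A generated by {χ^m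 : m ∈ P and ⟨m, b_ρ⟩ > 0 for some ρ ∈ σ(1)}. -/
open scoped BigOperators

noncomputable section

/-- The conical hull of a set `S` in `ℝ^d`: all finite nonnegative combinations of
elements of `S`.  For a finite set `S` this is the polyhedral cone `Cone(S)`. -/
def coneHull {d : ℕ} (S : Set (Fin d → ℝ)) : Set (Fin d → ℝ) :=
  {x | ∃ (T : Finset (Fin d → ℝ)) (c : (Fin d → ℝ) → ℝ),
    ↑T ⊆ S ∧ (∀ v ∈ T, 0 ≤ c v) ∧ x = ∑ v ∈ T, c v • v}

/-- A polyhedral cone is the conical hull of a finite set. -/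
def IsPolyhedralCone {d : ℕ} (σ : Set (Fin d → ℝ)) : Prop :=
  ∃ S : Finset (Fin d → ℝ), σ = coneHull ↑S

/-- A cone is strongly convex if it contains no line through the origin. -/
def StronglyConvex {d : ℕ} (σ : Set (Fin d → ℝ)) : Prop :=
  ∀ x ∈ σ, -x ∈ σ → x = 0

/-- `τ` is a face of `σ`: `τ = σ ∩ ker u` for a linear functional `u` nonnegative on `σ`. -/
def IsFaceOf {d : ℕ} (σ τ : Set (Fin d → ℝ)) : Prop :=
  ∃ u : (Fin d → ℝ) →ₗ[ℝ] ℝ, (∀ x ∈ σ, 0 ≤ u x) ∧ τ = {x ∈ σ | u x = 0}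

/-- The dimension of the linear span of a subset of `ℝ^d`. -/
def dimSet {d : ℕ} (s : Set (Fin d → ℝ)) : ℕ :=
  Module.finrank ℝ (Submodule.span ℝ s)

/-- The set of rays (one-dimensional faces) of a cone `σ`. -/
def raysOf {d : ℕ} (σ : Set (Fin d → ℝ)) : Set (Set (Fin d → ℝ)) :=
  {ρ | IsFaceOf σ ρ ∧ dimSet ρ = 1}

/-- The non-simplicial index `ns(σ) = |σ(1)| − dim σ`. -/
def nsCone {d : ℕ} (σ : Set (Fin d → ℝ)) : ℤ :=
  ((raysOf σ).ncard : ℤ) - (dimSet σ : ℤ)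

/-- A fan in `ℝ^d`: a finite collection of strongly convex polyhedral cones, closed
under taking faces, such that the intersection of any two cones is a face of each. -/
def IsFan {d : ℕ} (F : Set (Set (Fin d → ℝ))) : Prop :=
  F.Finite ∧ (∀ σ ∈ F, IsPolyhedralCone σ ∧ StronglyConvex σ) ∧
    (∀ σ ∈ F, ∀ τ, IsFaceOf σ τ → τ ∈ F) ∧
    (∀ σ ∈ F, ∀ σ' ∈ F, IsFaceOf σ (σ ∩ σ') ∧ IsFaceOf σ' (σ ∩ σ'))

/-- The non-simplicial index of a fan: `ns(Σ) = max_{σ ∈ Σ} ns(σ)`. -/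
def nsFan {d : ℕ} (F : Set (Set (Fin d → ℝ))) : ℤ :=
  sSup (nsCone '' F)

/-- A minimal non-simplicial cone of a fan `F`: a cone of `F` whose non-simplicial index
equals `ns(F)` and which is minimal with respect to inclusion among such cones. -/
def IsMinNonSimpCone {d : ℕ} (F : Set (Set (Fin d → ℝ))) (σ : Set (Fin d → ℝ)) : Prop :=
  σ ∈ F ∧ nsCone σ = nsFan F ∧
    ∀ τ ∈ F, nsCone τ = nsFan F → τ ⊆ σ → τ = σ

/-- The star subdivision of the fan `F` along the cone `σ` at the point `v0` (a point of
the relative interior of `σ`): it consists of the cones of `F` not containing `σ`,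
together with the cones `Cone(τ ∪ {v0})` for `μ` a cone of `F` containing `σ` and
`τ` a face of `μ` not containing `σ`. -/
def starSubdiv {d : ℕ} (F : Set (Set (Fin d → ℝ))) (σ : Set (Fin d → ℝ))
    (v0 : Fin d → ℝ) : Set (Set (Fin d → ℝ)) :=
  {μ ∈ F | ¬ σ ⊆ μ} ∪
    {c | ∃ μ ∈ F, σ ⊆ μ ∧ ∃ τ, IsFaceOf μ τ ∧ ¬ σ ⊆ τ ∧ c = coneHull (τ ∪ {v0})}

/-- The set of rays of a fan: `Σ(1)`, the rays of the cones of `Σ`. -/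
def fanRays {d : ℕ} (F : Set (Set (Fin d → ℝ))) : Set (Set (Fin d → ℝ)) :=
  {ρ | ∃ σ ∈ F, ρ ∈ raysOf σ}

/-- The monoid `P = σ^∨ ∩ ℤ^d` of integral linear functionals nonnegative on `σ`. -/
def dualMonoid {d : ℕ} (σ : Set (Fin d → ℝ)) : AddSubmonoid (Fin d → ℤ) where
  carrier := {m | ∀ x ∈ σ, 0 ≤ ∑ j, (m j : ℝ) * x j}
  zero_mem' := by intro x _; simp
  add_mem' := by
    intro a b ha hb x hx
    have h := add_nonneg (ha x hx) (hb x hx)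
    rw [← Finset.sum_add_distrib] at h
    calc (0 : ℝ) ≤ ∑ j, ((a j : ℝ) * x j + (b j : ℝ) * x j) := h
      _ = ∑ j, (((a + b) j : ℝ)) * x j := by
          refine Finset.sum_congr rfl fun j _ => ?_
          have : ((a + b) j : ℝ) = (a j : ℝ) + (b j : ℝ) := by simp [Pi.add_apply]
          rw [this]
          ring

open Classical in
/-- On the chart `U_σ` of the Cox construction, the ideal of the coordinate subspace
`L_σ` pulls back, under the map of coordinate rings
`χ^m ↦ ∏_ρ x_ρ^{⟨m, b_ρ⟩} : ℂ[σ^∨ ∩ ℤ^d] → S_σ`, to the ideal generated by the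
monomials `χ^m` with `⟨m, b_ρ⟩ > 0` for some ray `ρ` of `σ`.  This is the algebraic
content of `q(L_σ) = V(σ)`. -/
theorem stmt7 {d : ℕ} (F : Set (Set (Fin d → ℝ))) (hF : IsFan F)
    (hlat : ∀ μ ∈ F, ∃ S : Finset (Fin d → ℤ),
      μ = coneHull ((fun v : Fin d → ℤ => fun j => ((v j : ℝ))) '' ↑S))
    (hspan : Submodule.span ℝ (⋃ ρ ∈ fanRays F, ρ) = ⊤)
    (b : Set (Fin d → ℝ) → (Fin d → ℤ))
    (hb : ∀ ρ ∈ fanRays F, (fun j => ((b ρ j : ℝ))) ∈ ρ ∧ b ρ ≠ 0)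
    (σ : Set (Fin d → ℝ)) (hσ : σ ∈ F)
    (φ : AddMonoidAlgebra ℂ (dualMonoid σ) →ₐ[ℂ]
      AddMonoidAlgebra ℂ
        (({ρ : Set (Fin d → ℝ) // ρ ∈ raysOf σ} → ℕ) ×
         ({ρ : Set (Fin d → ℝ) // ρ ∈ fanRays F ∧ ρ ∉ raysOf σ} → ℤ)))
    (hφ : ∀ m : dualMonoid σ,
      φ (AddMonoidAlgebra.single m 1) =
        AddMonoidAlgebra.single
          (fun ρ : {ρ : Set (Fin d → ℝ) // ρ ∈ raysOf σ} =>
              (∑ j, (m : Fin d → ℤ) j * b ρ.1 j).toNat,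
           fun ρ : {ρ : Set (Fin d → ℝ) // ρ ∈ fanRays F ∧ ρ ∉ raysOf σ} =>
              ∑ j, (m : Fin d → ℤ) j * b ρ.1 j) 1) :
    Ideal.comap φ
        (Ideal.span {f | ∃ ρ : {ρ : Set (Fin d → ℝ) // ρ ∈ raysOf σ},
          f = AddMonoidAlgebra.single
            ((Pi.single ρ 1 : {ρ : Set (Fin d → ℝ) // ρ ∈ raysOf σ} → ℕ),
             (0 : {ρ : Set (Fin d → ℝ) // ρ ∈ fanRays F ∧ ρ ∉ raysOf σ} → ℤ)) 1}) =
      Ideal.span {g | ∃ m : dualMonoid σ,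
        (∃ ρ ∈ raysOf σ, 0 < ∑ j, (m : Fin d → ℤ) j * b ρ j) ∧
        g = AddMonoidAlgebra.single m 1} := by
  have hray : ∀ ρ ∈ raysOf σ, ρ ∈ fanRays F := fun ρ hρ => ⟨σ, hσ, hρ⟩
  have hnn : ∀ m : dualMonoid σ, ∀ ρ ∈ raysOf σ,
      0 ≤ ∑ j, (m : Fin d → ℤ) j * b ρ j := by
    intro m ρ hρ
    have h1 := (hb ρ (hray ρ hρ)).1
    obtain ⟨⟨u, hu, rfl⟩, _⟩ := hρ
    have h2 := m.2 _ h1.1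
    exact_mod_cast h2
  set e : dualMonoid σ → (({ρ : Set (Fin d → ℝ) // ρ ∈ raysOf σ} → ℕ) ×
         ({ρ : Set (Fin d → ℝ) // ρ ∈ fanRays F ∧ ρ ∉ raysOf σ} → ℤ)) := fun m =>
    (fun ρ => (∑ j, (m : Fin d → ℤ) j * b ρ.1 j).toNat,
     fun ρ => ∑ j, (m : Fin d → ℤ) j * b ρ.1 j) with he
  have hinj : Function.Injective e := by
    intro m m' h
    have hpair : ∀ ρ ∈ fanRays F,
        ∑ j, (m : Fin d → ℤ) j * b ρ j = ∑ j, (m' : Fin d → ℤ) j * b ρ j := by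
      intro ρ hρ
      by_cases hs : ρ ∈ raysOf σ
      · have h1 := congrFun (congrArg Prod.fst h) ⟨ρ, hs⟩
        simp only [he] at h1
        have := hnn m ρ hs
        have := hnn m' ρ hs
        omega
      · exact congrFun (congrArg Prod.snd h) ⟨ρ, hρ, hs⟩
    let L : (Fin d → ℝ) →ₗ[ℝ] ℝ :=
      ∑ j, (((m : Fin d → ℤ) j : ℝ) - ((m' : Fin d → ℤ) j : ℝ)) • LinearMap.proj j
    have hL : ∀ x, L x =
        ∑ j, (((m : Fin d → ℤ) j : ℝ) - ((m' : Fin d → ℤ) j : ℝ)) * x j := by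
      intro x
      simp [L, LinearMap.sum_apply]
    have hker : (⊤ : Submodule ℝ (Fin d → ℝ)) ≤ LinearMap.ker L := by
      rw [← hspan, Submodule.span_le]
      intro x hx
      simp only [Set.mem_iUnion] at hx
      obtain ⟨ρ, hρ, hxρ⟩ := hx
      obtain ⟨hbρ, hb0⟩ := hb ρ hρ
      obtain ⟨μ, hμ, hface, hdim⟩ := id hρ
      have hne : (⟨_, Submodule.subset_span hbρ⟩ : Submodule.span ℝ ρ) ≠ 0 := by
        intro h0
        apply hb0
        funext j
        have : ((b ρ j : ℤ) : ℝ) = 0 := congrFun (congrArg Subtype.val h0) j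
        exact_mod_cast this
      obtain ⟨c, hc⟩ := (finrank_eq_one_iff_of_nonzero' _ hne).1 hdim
        ⟨x, Submodule.subset_span hxρ⟩
      have hc' := congrArg Subtype.val hc
      simp only [Submodule.coe_smul] at hc'
      rw [SetLike.mem_coe, LinearMap.mem_ker, ← hc', map_smul, hL]
      have h3 : (∑ j, ((m : Fin d → ℤ) j : ℝ) * (b ρ j : ℝ)) =
          ∑ j, ((m' : Fin d → ℤ) j : ℝ) * (b ρ j : ℝ) := by
        exact_mod_cast hpair ρ hρ
      simp only [sub_mul, Finset.sum_sub_distrib, h3, sub_self, smul_zero]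
    ext i
    have h4 : L (Pi.single i 1) = 0 := hker (Submodule.mem_top)
    rw [hL] at h4
    simp [Pi.single_apply] at h4
    have h5 : ((m : Fin d → ℤ) i : ℝ) = ((m' : Fin d → ℤ) i : ℝ) := by linarith
    exact_mod_cast h5
  have hφ' : ∀ f, φ f = AddMonoidAlgebra.mapDomain e f := by
    intro f
    have : φ.toLinearMap = AddMonoidAlgebra.mapDomainLinearMap ℂ ℂ e := by
      apply AddMonoidAlgebra.lhom_ext'
      intro m
      ext
      simp [hφ, he]
    exact congrArg (fun l => l f) this
  have hset1 : {f | ∃ ρ : {ρ : Set (Fin d → ℝ) // ρ ∈ raysOf σ},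
          f = AddMonoidAlgebra.single
            ((Pi.single ρ 1 : {ρ : Set (Fin d → ℝ) // ρ ∈ raysOf σ} → ℕ),
             (0 : {ρ : Set (Fin d → ℝ) // ρ ∈ fanRays F ∧ ρ ∉ raysOf σ} → ℤ)) (1 : ℂ)} =
      AddMonoidAlgebra.of' ℂ _ '' (Set.range fun ρ =>
        ((Pi.single ρ 1 : {ρ : Set (Fin d → ℝ) // ρ ∈ raysOf σ} → ℕ),
             (0 : {ρ : Set (Fin d → ℝ) // ρ ∈ fanRays F ∧ ρ ∉ raysOf σ} → ℤ))) := by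
    ext f
    simp [AddMonoidAlgebra.of', eq_comm]
  have hset2 : {g | ∃ m : dualMonoid σ,
        (∃ ρ ∈ raysOf σ, 0 < ∑ j, (m : Fin d → ℤ) j * b ρ j) ∧
        g = AddMonoidAlgebra.single m (1 : ℂ)} =
      AddMonoidAlgebra.of' ℂ _ '' {m : dualMonoid σ |
        ∃ ρ ∈ raysOf σ, 0 < ∑ j, (m : Fin d → ℤ) j * b ρ j} := by
    ext f
    simp only [Set.mem_setOf_eq, Set.mem_image, AddMonoidAlgebra.of', eq_comm]
  rw [hset1, hset2]
  ext f
  rw [Ideal.mem_comap, AddMonoidAlgebra.mem_ideal_span_of'_image,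
    AddMonoidAlgebra.mem_ideal_span_of'_image, hφ']
  have hsupp : (AddMonoidAlgebra.mapDomain e f).coeff.support = f.coeff.support.image e :=
    Finsupp.mapDomain_support_of_injective hinj f.coeff
  rw [hsupp]
  simp only [Finset.forall_mem_image]
  refine forall₂_congr fun m _ => ?_
  constructor
  · rintro ⟨_, ⟨ρ, rfl⟩, k, hk⟩
    refine ⟨m, ⟨ρ.1, ρ.2, ?_⟩, 0, by simp⟩
    have h1 := congrFun (congrArg Prod.fst hk) ρ
    simp [he] at h1
    omega
  · rintro ⟨m', ⟨ρ, hρ, hpos⟩, k, rfl⟩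
    refine ⟨_, ⟨⟨ρ, hρ⟩, rfl⟩,
      ((e (k + m')).1 - Pi.single ⟨ρ, hρ⟩ 1, (e (k + m')).2), ?_⟩
    refine Prod.ext ?_ (by simp)
    have hle : (Pi.single ⟨ρ, hρ⟩ 1 : {ρ : Set (Fin d → ℝ) // ρ ∈ raysOf σ} → ℕ) ≤
        (e (k + m')).1 := by
      intro τ
      by_cases hτ : τ = ⟨ρ, hρ⟩
      · subst hτ
        have h0 := hnn k ρ hρ
        simp only [he, Pi.single_eq_same, AddSubmonoid.coe_add, Pi.add_apply, add_mul,
          Finset.sum_add_distrib]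
        omega
      · simp [Pi.single_eq_of_ne hτ]
    exact (tsub_add_cancel_of_le hle).symm
end
end

section
/- Let μ ⊂ ℝ^d be a strongly convex polyhedral cone with ray set μ(1) and let σ be a face of μ. In the polynomial ring ℂ[x_ρ : ρ ∈ μ(1)], let Ĩ be the ideal generated by the monomials x^{τ̂} = ∏_{ρ∈μ(1)∖τ(1)} x_ρ, where τ ranges over the faces of μ that do not contain σ. For a subset J ⊆ μ(1), let 𝔭_J be the ideal generated by {x_ρ : ρ ∈ J}, and let ν_J be the smallest face of μ containing every ray in J (it exists because the intersection of faces of μ is a face of μ). Then 𝔭_J ⊇ Ĩ if and only if σ ⊆ ν_J. -/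
open scoped BigOperators

noncomputable section

lemma face_sub {d : ℕ} (S : Finset (Fin d → ℝ)) (a b : Set (Fin d → ℝ))
    (ha : IsFaceOf (coneHull (S : Set (Fin d → ℝ))) a)
    (hb : IsFaceOf (coneHull (S : Set (Fin d → ℝ))) b)
    (h : a ∩ S ⊆ b ∩ S) : a ⊆ b := by
  obtain ⟨u, hu, rfl⟩ := ha
  obtain ⟨w, hw, rfl⟩ := hb
  rintro x ⟨hx, hux⟩
  refine ⟨hx, ?_⟩
  obtain ⟨T, c, hT, hc, rfl⟩ := hx
  have hmem : ∀ v ∈ T, v ∈ coneHull (S : Set (Fin d → ℝ)) := fun v hv =>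
    ⟨{v}, fun _ => 1, by simpa using hT hv, by simp, by simp⟩
  simp only [map_sum, map_smul, smul_eq_mul] at hux ⊢
  rw [Finset.sum_eq_zero_iff_of_nonneg
    (fun v hv => mul_nonneg (hc v hv) (hu v (hmem v hv)))] at hux
  refine Finset.sum_eq_zero fun v hv => ?_
  rcases mul_eq_zero.1 (hux v hv) with h0 | h0
  · simp [h0]
  · have := (h ⟨⟨hmem v hv, h0⟩, hT hv⟩).1.2
    simp [this]

lemma rays_finite {d : ℕ} (μ : Set (Fin d → ℝ)) (hμ : IsPolyhedralCone μ) :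
    (raysOf μ).Finite := by
  obtain ⟨S, rfl⟩ := hμ
  refine Set.Finite.of_finite_image (f := fun a => a ∩ (S : Set (Fin d → ℝ))) ?_ ?_
  · refine (S.finite_toSet.finite_subsets).subset ?_
    rintro _ ⟨a, -, rfl⟩
    exact Set.inter_subset_right
  · intro a ha b hb h
    exact (face_sub S a b ha.1 hb.1 h.le).antisymm (face_sub S b a hb.1 ha.1 h.ge)

/-- For a strongly convex polyhedral cone `μ` with face `σ`, and the monomial ideal
`Ĩ` generated by the `x^{τ̂} = ∏_{ρ ∈ μ(1)∖τ(1)} x_ρ` for `τ` a face of `μ` not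
containing `σ`: a monomial prime `𝔭_J` (for `J ⊆ μ(1)`) contains `Ĩ` if and only if
the smallest face `ν_J` of `μ` containing all rays in `J` contains `σ`. -/
theorem stmt8 {d : ℕ} (μ : Set (Fin d → ℝ)) (hμ : IsPolyhedralCone μ)
    (hsc : StronglyConvex μ) (σ : Set (Fin d → ℝ)) (hσ : IsFaceOf μ σ)
    (J : Set {ρ : Set (Fin d → ℝ) // ρ ∈ raysOf μ})
    (ν : Set (Fin d → ℝ)) (hν : IsFaceOf μ ν)
    (hνJ : ∀ ρ ∈ J, (ρ : Set (Fin d → ℝ)) ⊆ ν)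
    (hνmin : ∀ ν', IsFaceOf μ ν' → (∀ ρ ∈ J, (ρ : Set (Fin d → ℝ)) ⊆ ν') → ν ⊆ ν') :
    Ideal.span {f : MvPolynomial {ρ : Set (Fin d → ℝ) // ρ ∈ raysOf μ} ℂ |
        ∃ τ, IsFaceOf μ τ ∧ ¬ σ ⊆ τ ∧
          f = ∏ᶠ (ρ : {ρ : Set (Fin d → ℝ) // ρ ∈ raysOf μ})
                (_ : ¬ (ρ : Set (Fin d → ℝ)) ⊆ τ), MvPolynomial.X ρ} ≤
      Ideal.span (MvPolynomial.X '' J) ↔ σ ⊆ ν := by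
  classical
  haveI : Finite {ρ : Set (Fin d → ℝ) // ρ ∈ raysOf μ} := (rays_finite μ hμ).to_subtype
  haveI := Fintype.ofFinite {ρ : Set (Fin d → ℝ) // ρ ∈ raysOf μ}
  have key : ∀ τ : Set (Fin d → ℝ),
      (∏ᶠ (ρ : {ρ : Set (Fin d → ℝ) // ρ ∈ raysOf μ})
        (_ : ¬ (ρ : Set (Fin d → ℝ)) ⊆ τ), (MvPolynomial.X ρ :
          MvPolynomial {ρ : Set (Fin d → ℝ) // ρ ∈ raysOf μ} ℂ)) =
      ∏ ρ ∈ Finset.univ.filter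
        (fun ρ : {ρ : Set (Fin d → ℝ) // ρ ∈ raysOf μ} => ¬ (ρ : Set (Fin d → ℝ)) ⊆ τ),
        MvPolynomial.X ρ := by
    intro τ
    rw [← finprod_mem_finset_eq_prod]
    simp
  constructor
  · intro h
    by_contra hcon
    have h1 := h (Ideal.subset_span ⟨ν, hν, hcon, rfl⟩)
    rw [key] at h1
    let φ : MvPolynomial {ρ : Set (Fin d → ℝ) // ρ ∈ raysOf μ} ℂ →ₐ[ℂ] ℂ :=
      MvPolynomial.aeval (fun ρ => if ρ ∈ J then 0 else 1)
    have h2 : Ideal.span (MvPolynomial.X '' J) ≤ RingHom.ker φ := by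
      rw [Ideal.span_le]
      rintro _ ⟨ρ, hρ, rfl⟩
      simp [φ, RingHom.mem_ker, hρ]
    have h3 := h2 h1
    rw [RingHom.mem_ker, map_prod, Finset.prod_eq_zero_iff] at h3
    obtain ⟨ρ, hρ, h0⟩ := h3
    simp [φ] at h0 hρ
    exact hρ (hνJ _ h0)
  · intro h
    rw [Ideal.span_le]
    rintro _ ⟨τ, hτ, hστ, rfl⟩
    rw [key]
    have : ∃ ρ ∈ J, ¬ (ρ : Set (Fin d → ℝ)) ⊆ τ := by
      by_contra hcon
      push Not at hcon
      exact hστ (h.trans (hνmin τ hτ hcon))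
    obtain ⟨ρ, hρ, hn⟩ := this
    exact Ideal.mem_of_dvd _ (Finset.dvd_prod_of_mem _ (by simp [hn]))
      (Ideal.subset_span ⟨ρ, hρ, rfl⟩)
end
end

section
/- Let μ ⊂ ℝ^d be a strongly convex polyhedral cone generated by finitely many vectors in ℤ^d, with ray set μ(1) and a chosen nonzero lattice vector b_ρ ∈ ρ ∩ ℤ^d on each ray ρ ∈ μ(1), and let σ be a face of μ. In the polynomial ring ℂ[x_ρ : ρ ∈ μ(1)], let Ĩ be the ideal generated by the monomials x^{τ̂} = ∏_{ρ∈μ(1)∖τ(1)} x_ρ, where τ ranges over the faces of μ not containing σ, and let K be the ideal generated by the monomials ∏_{ρ∈μ(1)} x_ρ^{⟨m, b_ρ⟩} over all m ∈ ℤ^d satisfying ⟨m, x⟩ ≥ 0 for all x ∈ μ and ⟨m, b_ρ⟩ > 0 for some ρ ∈ σ(1). Then Ĩ is contained in the radical of K. -/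
open scoped BigOperators

noncomputable section

lemma mem_coneHull_finset {d : ℕ} (T : Finset (Fin d → ℝ)) (x : Fin d → ℝ) :
    x ∈ coneHull (↑T : Set (Fin d → ℝ)) ↔
      ∃ c : (Fin d → ℝ) → ℝ, (∀ v ∈ T, 0 ≤ c v) ∧ x = ∑ v ∈ T, c v • v := by
  classical
  constructor
  · rintro ⟨T', c, hT, hc, rfl⟩
    refine ⟨fun v => if v ∈ T' then c v else 0, ?_, ?_⟩
    · intro v _
      dsimp only
      split_ifs with h
      · exact hc v h
      · exact le_rfl
    · have hT' : T' ⊆ T := by exact_mod_cast hT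
      rw [← Finset.sum_subset hT']
      · exact Finset.sum_congr rfl fun v hv => by simp [hv]
      · intro v _ hv
        simp [hv]
  · rintro ⟨c, hc, rfl⟩
    exact ⟨T, c, subset_rfl, hc, rfl⟩

lemma gen_mem {d : ℕ} {T : Finset (Fin d → ℝ)} {v : Fin d → ℝ} (hv : v ∈ T) :
    v ∈ coneHull (↑T : Set (Fin d → ℝ)) :=
  ⟨{v}, fun _ => 1, by simpa using hv, by simp, by simp⟩

lemma erase_cone {d : ℕ} [DecidableEq (Fin d → ℝ)] {T : Finset (Fin d → ℝ)} {v : Fin d → ℝ} (hv : v ∈ T)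
    (h : v ∈ coneHull (↑(T.erase v) : Set (Fin d → ℝ))) :
    coneHull (↑(T.erase v) : Set (Fin d → ℝ)) = coneHull (↑T : Set (Fin d → ℝ)) := by
  obtain ⟨e, he, hve⟩ := (mem_coneHull_finset _ _).1 h
  ext x
  constructor
  · rintro ⟨T', c, hT, hc, rfl⟩
    exact ⟨T', c, hT.trans (by simp), hc, rfl⟩
  · intro hx
    obtain ⟨c, hc, rfl⟩ := (mem_coneHull_finset _ _).1 hx
    refine (mem_coneHull_finset _ _).2 ⟨fun w => c w + c v * e w, ?_, ?_⟩
    · intro w hw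
      exact add_nonneg (hc w (Finset.mem_of_mem_erase hw)) (mul_nonneg (hc v hv) (he w hw))
    · rw [← Finset.add_sum_erase T _ hv]
      simp only [add_smul, Finset.sum_add_distrib, mul_smul]
      rw [← Finset.smul_sum, ← hve, add_comm]

lemma exists_min_gen {d : ℕ} [DecidableEq (Fin d → ℝ)] (T : Finset (Fin d → ℝ)) :
    ∃ T' : Finset (Fin d → ℝ), coneHull (↑T' : Set (Fin d → ℝ)) = coneHull (↑T : Set (Fin d → ℝ)) ∧
      ∀ v ∈ T', v ∉ coneHull (↑(T'.erase v) : Set (Fin d → ℝ)) := by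
  induction hn : T.card using Nat.strong_induction_on generalizing T with
  | _ n ih =>
    by_cases h : ∀ v ∈ T, v ∉ coneHull (↑(T.erase v) : Set (Fin d → ℝ))
    · exact ⟨T, rfl, h⟩
    · push Not at h
      obtain ⟨v, hv, hh⟩ := h
      obtain ⟨T', h1, h2⟩ := ih _ (by rw [← hn]; exact Finset.card_erase_lt_of_mem hv) (T.erase v) rfl
      exact ⟨T', h1.trans (erase_cone hv hh), h2⟩

lemma exists_functional {d : ℕ} [DecidableEq (Fin d → ℝ)] (T : Finset (Fin d → ℝ))
    (hsc : StronglyConvex (coneHull (↑T : Set (Fin d → ℝ))))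
    (hmin : ∀ v ∈ T, v ∉ coneHull (↑(T.erase v) : Set (Fin d → ℝ))) (v : Fin d → ℝ) (hv : v ∈ T) :
    ∃ f : (Fin d → ℝ) →ₗ[ℝ] ℝ, f v = 0 ∧ ∀ w ∈ T.erase v, 0 < f w := by
  have hne : ∀ w ∈ T, w ≠ 0 := by
    rintro w hw rfl
    exact hmin _ hw ⟨∅, fun _ => 0, by simp, by simp, by simp⟩
  have hdisj : Disjoint (convexHull ℝ (↑(T.erase v) : Set (Fin d → ℝ)))
      (↑(Submodule.span ℝ {v}) : Set (Fin d → ℝ)) := by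
    rw [Set.disjoint_left]
    intro x hx hx2
    obtain ⟨c, hc, hc1, hcx⟩ := Finset.mem_convexHull'.1 hx
    obtain ⟨t, rfl⟩ := Submodule.mem_span_singleton.1 hx2
    rcases lt_or_ge 0 t with ht | ht
    · apply hmin v hv
      refine (mem_coneHull_finset _ _).2 ⟨fun w => t⁻¹ * c w, fun w hw =>
        mul_nonneg (inv_nonneg.2 ht.le) (hc w hw), ?_⟩
      simp only [mul_smul]
      rw [← Finset.smul_sum, hcx, smul_smul, inv_mul_cancel₀ ht.ne', one_smul]
    · obtain ⟨w, hw, hcw⟩ : ∃ w ∈ T.erase v, 0 < c w := by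
        by_contra! hcon
        have : ∑ w ∈ T.erase v, c w ≤ 0 := Finset.sum_nonpos hcon
        linarith
      have hwT := Finset.mem_of_mem_erase hw
      have hz : c w • w = 0 := by
        apply hsc
        · exact ⟨{w}, c, by simpa using hwT, by simpa using hcw.le, by simp⟩
        · refine (mem_coneHull_finset _ _).2 ⟨fun z => if z = v then -t else if z = w then 0 else c z, ?_, ?_⟩
          · intro z hz
            dsimp only
            split_ifs with h1 h2
            · linarith
            · exact le_rfl
            · exact hc z (Finset.mem_erase.2 ⟨h1, hz⟩)
          · rw [← Finset.add_sum_erase T _ hv, ← Finset.add_sum_erase _ _ hw]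
            rw [← Finset.add_sum_erase _ _ hw] at hcx
            have hwv : w ≠ v := (Finset.mem_erase.1 hw).1
            have : ∑ x ∈ (T.erase v).erase w, (if x = v then -t else if x = w then 0 else c x) • x
              = ∑ x ∈ (T.erase v).erase w, c x • x := by
              apply Finset.sum_congr rfl
              intro z hz
              simp only [Finset.mem_erase] at hz
              simp [hz.1, hz.2.1]
            rw [this]
            simp only [hwv, if_true, if_false, zero_smul, zero_add, neg_smul]
            rw [← hcx]
            abel
      rcases smul_eq_zero.1 hz with h | h
      · linarith
      · exact hne w hwT h
  obtain ⟨f, a, b, h1, h2, h3⟩ := geometric_hahn_banach_compact_closed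
    (convex_convexHull ℝ _) ((T.erase v).finite_toSet.isCompact_convexHull (𝕜 := ℝ))
    (Submodule.convex _) (Submodule.closed_of_finiteDimensional (Submodule.span ℝ {v})) hdisj
  have hb0 : b < 0 := by simpa using h3 0 (Submodule.zero_mem _)
  have hfv : f v = 0 := by
    by_contra hfv
    have := h3 ((b / f v) • v) (Submodule.mem_span_singleton.2 ⟨_, rfl⟩)
    rw [map_smul, smul_eq_mul, div_mul_cancel₀ _ hfv] at this
    exact lt_irrefl _ this
  refine ⟨-(f : (Fin d → ℝ) →ₗ[ℝ] ℝ), by simp [hfv], ?_⟩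
  intro w hw
  have := h1 w (subset_convexHull ℝ _ hw)
  simp
  linarith

lemma exists_ray {d : ℕ} (T : Finset (Fin d → ℝ)) (μ σ : Set (Fin d → ℝ))
    (hμ : μ = coneHull (↑T : Set (Fin d → ℝ)))
    (hsc : StronglyConvex μ) (hσ : IsFaceOf μ σ)
    (u : (Fin d → ℝ) →ₗ[ℝ] ℝ) (hu : ∀ x ∈ μ, 0 ≤ u x) (x : Fin d → ℝ) (hx : x ∈ σ) (hux : u x ≠ 0) :
    ∃ ρ ∈ raysOf μ, ρ ⊆ σ ∧ ∀ y ∈ ρ, y ≠ 0 → u y ≠ 0 := by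
  classical
  obtain ⟨T', hT', hmin⟩ := exists_min_gen T
  rw [← hT'] at hμ
  obtain ⟨s, hs, rfl⟩ := hσ
  obtain ⟨hxμ, hsx⟩ := hx
  have hxμ' := hxμ
  rw [hμ] at hxμ'
  obtain ⟨c, hc, hcx⟩ := (mem_coneHull_finset _ _).1 hxμ'
  have hgen : ∀ w ∈ T', w ∈ μ := fun w hw => hμ ▸ gen_mem hw
  have hsum : ∑ w ∈ T', c w * s w = 0 := by
    rw [hcx] at hsx
    simpa using hsx
  have hz := (Finset.sum_eq_zero_iff_of_nonneg
    (fun w hw => mul_nonneg (hc w hw) (hs w (hgen w hw)))).1 hsum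
  obtain ⟨v, hv, hvne⟩ : ∃ v ∈ T', c v * u v ≠ 0 := by
    by_contra! hcon
    apply hux
    rw [hcx]
    simpa using Finset.sum_eq_zero hcon
  have hcv : c v ≠ 0 := left_ne_zero_of_mul hvne
  have huv : u v ≠ 0 := right_ne_zero_of_mul hvne
  have hsv : s v = 0 := (mul_eq_zero.1 (hz v hv)).resolve_left hcv
  obtain ⟨f, hfv, hf⟩ := exists_functional T' (hμ ▸ hsc) hmin v hv
  have hv0 : v ≠ 0 := by
    rintro rfl
    simp at huv
  have hf0 : ∀ w ∈ T', 0 ≤ f w := by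
    intro w hw
    by_cases h : w = v
    · rw [h, hfv]
    · exact (hf w (Finset.mem_erase.2 ⟨h, hw⟩)).le
  have hray : ∀ y ∈ μ, f y = 0 → ∃ t : ℝ, y = t • v := by
    intro y hy hfy
    rw [hμ] at hy
    obtain ⟨e, he, rfl⟩ := (mem_coneHull_finset _ _).1 hy
    have hsum : ∑ w ∈ T', e w * f w = 0 := by simpa using hfy
    have hz := (Finset.sum_eq_zero_iff_of_nonneg
      (fun w hw => mul_nonneg (he w hw) (hf0 w hw))).1 hsum
    refine ⟨e v, Finset.sum_eq_single_of_mem v hv ?_⟩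
    intro w hw hwv
    rw [(mul_eq_zero.1 (hz w hw)).resolve_right (hf w (Finset.mem_erase.2 ⟨hwv, hw⟩)).ne', zero_smul]
  refine ⟨{y ∈ μ | f y = 0}, ⟨⟨f, ?_, rfl⟩, ?_⟩, ?_, ?_⟩
  · intro y hy
    rw [hμ] at hy
    obtain ⟨e, he, rfl⟩ := (mem_coneHull_finset _ _).1 hy
    simp only [map_sum, map_smul, smul_eq_mul]
    exact Finset.sum_nonneg fun w hw => mul_nonneg (he w hw) (hf0 w hw)
  · have : Submodule.span ℝ {y ∈ μ | f y = 0} = Submodule.span ℝ {v} := by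
      apply le_antisymm
      · rw [Submodule.span_le]
        rintro y ⟨hy, hfy⟩
        obtain ⟨t, rfl⟩ := hray y hy hfy
        exact Submodule.mem_span_singleton.2 ⟨t, rfl⟩
      · apply Submodule.span_mono
        rintro _ rfl
        exact ⟨hgen _ hv, hfv⟩
    rw [dimSet, this]
    exact finrank_span_singleton hv0
  · rintro y ⟨hy, hfy⟩
    obtain ⟨t, rfl⟩ := hray y hy hfy
    exact ⟨hy, by simp [hsv]⟩
  · rintro y ⟨hy, hfy⟩ hy0
    obtain ⟨t, rfl⟩ := hray y hy hfy
    have : t ≠ 0 := by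
      rintro rfl
      simp at hy0
    simp [this, huv]

lemma rays_finite_s10 {d : ℕ} (T : Finset (Fin d → ℝ)) :
    (raysOf (coneHull (↑T : Set (Fin d → ℝ)))).Finite := by
  classical
  apply Set.Finite.of_injOn (f := fun ρ => ρ ∩ (↑T : Set (Fin d → ℝ))) (t := 𝒫 (↑T : Set (Fin d → ℝ)))
  · intro ρ _
    exact Set.inter_subset_right
  · have key : ∀ u : (Fin d → ℝ) →ₗ[ℝ] ℝ, (∀ x ∈ coneHull (↑T : Set (Fin d → ℝ)), 0 ≤ u x) →
        ∀ s : (Fin d → ℝ) →ₗ[ℝ] ℝ, (∀ x ∈ coneHull (↑T : Set (Fin d → ℝ)), 0 ≤ s x) →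
        (∀ v ∈ T, u v = 0 → s v = 0) → ∀ x ∈ coneHull (↑T : Set (Fin d → ℝ)), u x = 0 → s x = 0 := by
      intro u hu s hs h x hx hux
      obtain ⟨e, he, rfl⟩ := (mem_coneHull_finset _ _).1 hx
      have hsum : ∑ w ∈ T, e w * u w = 0 := by simpa using hux
      have hz := (Finset.sum_eq_zero_iff_of_nonneg
        (fun w hw => mul_nonneg (he w hw) (hu w (gen_mem hw)))).1 hsum
      simp only [map_sum, map_smul, smul_eq_mul]
      apply Finset.sum_eq_zero
      intro w hw
      rcases mul_eq_zero.1 (hz w hw) with h' | h'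
      · simp [h']
      · simp [h w hw h']
    rintro ρ ⟨⟨u, hu, rfl⟩, _⟩ ρ' ⟨⟨s, hs, rfl⟩, _⟩ heq
    have hiff : ∀ v ∈ T, (u v = 0 ↔ s v = 0) := by
      intro v hv
      have := Set.ext_iff.1 heq v
      simpa [hv, gen_mem hv] using this
    ext x
    constructor
    · rintro ⟨h1, h2⟩
      exact ⟨h1, key u hu s hs (fun v hv => (hiff v hv).1) x h1 h2⟩
    · rintro ⟨h1, h2⟩
      exact ⟨h1, key s hs u hu (fun v hv => (hiff v hv).2) x h1 h2⟩
  · exact T.finite_toSet.finite_subsets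

lemma exists_int_vec {d : ℕ} (S : Finset (Fin d → ℤ)) (a : Fin d → ℝ)
    (ha : ∀ v ∈ S, 0 ≤ ∑ j, a j * (v j : ℝ)) :
    ∃ m : Fin d → ℤ, ∀ v ∈ S, (0 ≤ ∑ j, (m j : ℝ) * (v j : ℝ)) ∧
      (∑ j, (m j : ℝ) * (v j : ℝ) = 0 ↔ ∑ j, a j * (v j : ℝ) = 0) := by
  classical
  let W := Submodule.span ℚ (Set.range a)
  haveI : FiniteDimensional ℚ W := FiniteDimensional.span_of_finite ℚ (Set.finite_range a)
  let B := Module.finBasis ℚ W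
  let a' : Fin d → W := fun j => ⟨a j, Submodule.subset_span ⟨j, rfl⟩⟩
  let q : Fin d → Fin (Module.finrank ℚ W) → ℚ := fun j i => B.repr (a' j) i
  have haq : ∀ j, a j = ∑ i, (q j i : ℝ) * (B i : ℝ) := by
    intro j
    have h := congrArg (Subtype.val) (B.sum_repr (a' j))
    simp only [Submodule.coe_sum, Submodule.coe_smul, Rat.smul_def] at h
    exact h.symm
  have hzero : ∀ v : Fin d → ℤ, ∑ j, a j * (v j : ℝ) = 0 → ∀ i, ∑ j, q j i * (v j : ℚ) = 0 := by
    intro v hv i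
    have h0 : ∑ j, (v j : ℚ) • a' j = 0 := by
      apply Subtype.ext
      simp only [Submodule.coe_sum, Submodule.coe_smul, Rat.smul_def]
      simpa [a', mul_comm] using hv
    have := congrArg (fun w => B.repr w i) h0
    simpa [q, mul_comm, Finsupp.finset_sum_apply] using this
  let F : (Fin d → ℤ) → (Fin (Module.finrank ℚ W) → ℝ) → ℝ :=
    fun v r => ∑ j, (∑ i, (q j i : ℝ) * r i) * (v j : ℝ)
  have hFc : ∀ v, Continuous (F v) := by
    intro v
    fun_prop
  let U : Set (Fin (Module.finrank ℚ W) → ℝ) :=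
    ⋂ v ∈ S.filter (fun v => 0 < ∑ j, a j * (v j : ℝ)), {r | 0 < F v r}
  have hU : IsOpen U := isOpen_biInter_finset fun v _ => isOpen_lt continuous_const (hFc v)
  have hUne : U.Nonempty := by
    refine ⟨fun i => (B i : ℝ), ?_⟩
    simp only [U, Set.mem_iInter]
    intro v hv
    simp only [Set.mem_setOf_eq, F, ← haq]
    exact (Finset.mem_filter.1 hv).2
  have hdense : DenseRange (fun (r : Fin (Module.finrank ℚ W) → ℚ) => fun i => (r i : ℝ)) :=
    DenseRange.piMap (fun _ => Rat.denseRange_cast)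
  obtain ⟨r, hr⟩ := hdense.exists_mem_open hU hUne
  let w : Fin d → ℚ := fun j => ∑ i, q j i * r i
  let D : ℕ := ∏ j, (w j).den
  have hD : 0 < D := Finset.prod_pos fun j _ => (w j).den_pos
  have hm : ∀ j, ∃ z : ℤ, (z : ℚ) = D * w j := by
    intro j
    obtain ⟨k, hk⟩ : (w j).den ∣ D := Finset.dvd_prod_of_mem _ (Finset.mem_univ j)
    refine ⟨k * (w j).num, ?_⟩
    rw [hk]
    push_cast
    have := Rat.mul_den_eq_num (w j)
    rw [← this]
    ring
  choose m hm using hm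
  have hmF : ∀ v : Fin d → ℤ, ∑ j, (m j : ℝ) * (v j : ℝ) = D * F v (fun i => (r i : ℝ)) := by
    intro v
    simp only [F, Finset.mul_sum]
    apply Finset.sum_congr rfl
    intro j _
    have h : ((m j : ℚ) : ℝ) = ((D * w j : ℚ) : ℝ) := by rw [hm j]
    push_cast [w] at h
    rw [h, mul_assoc]
  have hDR : (0 : ℝ) < D := by exact_mod_cast hD
  refine ⟨m, fun v hv => ?_⟩
  rw [hmF]
  rcases (ha v hv).lt_or_eq with hpos | h0
  · have : 0 < F v (fun i => (r i : ℝ)) := by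
      simp only [U, Set.mem_iInter] at hr
      exact hr v (Finset.mem_filter.2 ⟨hv, hpos⟩)
    have h2 := mul_pos hDR this
    exact ⟨h2.le, ⟨fun h => absurd h h2.ne', fun h => absurd h hpos.ne'⟩⟩
  · have hq := hzero v h0.symm
    have : F v (fun i => (r i : ℝ)) = 0 := by
      simp only [F, Finset.sum_mul]
      rw [Finset.sum_comm]
      apply Finset.sum_eq_zero
      intro i _
      have h : ((∑ j, q j i * (v j : ℚ) : ℚ) : ℝ) = 0 := by rw [hq i]; simp
      push_cast at h
      calc _ = (∑ j, (q j i : ℝ) * (v j : ℝ)) * r i := by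
            rw [Finset.sum_mul]
            exact Finset.sum_congr rfl fun j _ => by ring
        _ = 0 := by rw [h, zero_mul]
    rw [this]
    simp [h0.symm]

lemma exists_int_functional {d : ℕ} (S : Finset (Fin d → ℤ)) (μ : Set (Fin d → ℝ))
    (hμ : μ = coneHull ((fun v : Fin d → ℤ => fun j => ((v j : ℝ))) '' ↑S))
    (u : (Fin d → ℝ) →ₗ[ℝ] ℝ) (hu : ∀ x ∈ μ, 0 ≤ u x) :
    ∃ m : Fin d → ℤ, ∀ x ∈ μ, (0 ≤ ∑ j, (m j : ℝ) * x j) ∧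
      (∑ j, (m j : ℝ) * x j = 0 ↔ u x = 0) := by
  classical
  have hua : ∀ x, u x = ∑ j, u (Pi.single j 1) * x j := by
    intro x
    conv_lhs => rw [← Finset.univ_sum_single x]
    rw [map_sum]
    apply Finset.sum_congr rfl
    intro j _
    have : (Pi.single j (x j) : Fin d → ℝ) = x j • Pi.single j 1 := by
      rw [← Pi.single_smul]; simp
    rw [this, map_smul, smul_eq_mul, mul_comm]
  rw [← Finset.coe_image] at hμ
  have hgen : ∀ v ∈ S, (fun j => ((v j : ℝ))) ∈ μ := by
    intro v hv
    rw [hμ]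
    exact gen_mem (Finset.mem_image_of_mem _ hv)
  obtain ⟨m, hm⟩ := exists_int_vec S (fun j => u (Pi.single j 1)) (by
    intro v hv
    have := hu _ (hgen v hv)
    rwa [hua] at this)
  refine ⟨m, fun x hx => ?_⟩
  rw [hμ] at hx
  obtain ⟨c, hc, hcx⟩ := (mem_coneHull_finset _ _).1 hx
  have h1 : ∑ j, (m j : ℝ) * x j =
      ∑ w ∈ S.image (fun v : Fin d → ℤ => fun j => ((v j : ℝ))), c w * ∑ j, (m j : ℝ) * w j := by
    rw [hcx]
    simp only [Finset.sum_apply, Pi.smul_apply, smul_eq_mul, Finset.mul_sum]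
    rw [Finset.sum_comm]
    exact Finset.sum_congr rfl fun _ _ => Finset.sum_congr rfl fun _ _ => by ring
  have h2 : u x = ∑ w ∈ S.image (fun v : Fin d → ℤ => fun j => ((v j : ℝ))), c w * u w := by
    rw [hcx]
    simp
  have hm' : ∀ w ∈ S.image (fun v : Fin d → ℤ => fun j => ((v j : ℝ))),
      (0 ≤ ∑ j, (m j : ℝ) * w j) ∧ (∑ j, (m j : ℝ) * w j = 0 ↔ u w = 0) ∧ 0 ≤ u w := by
    intro w hw
    obtain ⟨v, hv, rfl⟩ := Finset.mem_image.1 hw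
    refine ⟨(hm v hv).1, ?_, hu _ (hgen v hv)⟩
    rw [hua]
    exact (hm v hv).2
  rw [h1, h2]
  refine ⟨Finset.sum_nonneg fun w hw => mul_nonneg (hc w hw) (hm' w hw).1, ?_⟩
  rw [Finset.sum_eq_zero_iff_of_nonneg fun w hw => mul_nonneg (hc w hw) (hm' w hw).1,
    Finset.sum_eq_zero_iff_of_nonneg fun w hw => mul_nonneg (hc w hw) (hm' w hw).2.2]
  refine forall₂_congr fun w hw => ?_
  rw [mul_eq_zero, mul_eq_zero, (hm' w hw).2.1]

/-- Step I of Proposition `prop.ltilde`: in `ℂ[x_ρ : ρ ∈ μ(1)]`, the monomial ideal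
`Ĩ` generated by the `x^{τ̂}` (for `τ` a face of `μ` not containing the face `σ`)
is contained in the radical of the ideal `K` generated by the monomials
`∏_ρ x_ρ^{⟨m, b_ρ⟩}` over all `m ∈ ℤ^d` nonnegative on `μ` with `⟨m, b_ρ⟩ > 0`
for some ray `ρ` of `σ`. -/
theorem stmt10 {d : ℕ} (μ : Set (Fin d → ℝ))
    (hμ : ∃ S : Finset (Fin d → ℤ),
      μ = coneHull ((fun v : Fin d → ℤ => fun j => ((v j : ℝ))) '' ↑S))
    (hsc : StronglyConvex μ) (σ : Set (Fin d → ℝ)) (hσ : IsFaceOf μ σ)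
    (b : {ρ : Set (Fin d → ℝ) // ρ ∈ raysOf μ} → (Fin d → ℤ))
    (hb : ∀ ρ : {ρ : Set (Fin d → ℝ) // ρ ∈ raysOf μ},
      (fun j => ((b ρ j : ℝ))) ∈ ρ.1 ∧ b ρ ≠ 0) :
    Ideal.span {f : MvPolynomial {ρ : Set (Fin d → ℝ) // ρ ∈ raysOf μ} ℂ |
        ∃ τ, IsFaceOf μ τ ∧ ¬ σ ⊆ τ ∧
          f = ∏ᶠ (ρ : {ρ : Set (Fin d → ℝ) // ρ ∈ raysOf μ})
                (_ : ¬ (ρ : Set (Fin d → ℝ)) ⊆ τ), MvPolynomial.X ρ} ≤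
      (Ideal.span {f : MvPolynomial {ρ : Set (Fin d → ℝ) // ρ ∈ raysOf μ} ℂ |
        ∃ m : Fin d → ℤ,
          (∀ x ∈ μ, 0 ≤ ∑ j, (m j : ℝ) * x j) ∧
          (∃ ρ : {ρ : Set (Fin d → ℝ) // ρ ∈ raysOf μ},
            (ρ : Set (Fin d → ℝ)) ⊆ σ ∧ 0 < ∑ j, m j * b ρ j) ∧
          f = ∏ᶠ ρ : {ρ : Set (Fin d → ℝ) // ρ ∈ raysOf μ},
                MvPolynomial.X ρ ^ (∑ j, m j * b ρ j).toNat}).radical := by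
  classical
  obtain ⟨S, hS⟩ := hμ
  have hT : μ = coneHull (↑(S.image (fun v : Fin d → ℤ => fun j => ((v j : ℝ)))) : Set (Fin d → ℝ)) := by
    rw [Finset.coe_image]
    exact hS
  haveI : Finite {ρ : Set (Fin d → ℝ) // ρ ∈ raysOf μ} := by
    have := rays_finite_s10 (S.image (fun v : Fin d → ℤ => fun j => ((v j : ℝ))))
    rw [← hT] at this
    exact this.to_subtype
  haveI := Fintype.ofFinite {ρ : Set (Fin d → ℝ) // ρ ∈ raysOf μ}
  rw [Ideal.span_le]
  rintro f ⟨τ, ⟨u, hu, rfl⟩, hστ, rfl⟩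
  obtain ⟨x, hxσ, hxτ⟩ := Set.not_subset.1 hστ
  have hxμ : x ∈ μ := by
    obtain ⟨s, _, rfl⟩ := hσ
    exact hxσ.1
  have hux : u x ≠ 0 := fun h => hxτ ⟨hxμ, h⟩
  obtain ⟨m, hm⟩ := exists_int_functional S μ hS u hu
  obtain ⟨ρ, hρ, hρσ, hρu⟩ := exists_ray _ μ σ hT hsc hσ u hu x hxσ hux
  have hbμ : ∀ ρ : {ρ : Set (Fin d → ℝ) // ρ ∈ raysOf μ}, (fun j => ((b ρ j : ℝ))) ∈ μ := by
    intro ρ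
    have h1 := (hb ρ).1
    obtain ⟨s, _, hs⟩ := ρ.2.1
    rw [hs] at h1
    exact h1.1
  let e : {ρ : Set (Fin d → ℝ) // ρ ∈ raysOf μ} → ℕ := fun ρ => (∑ j, m j * b ρ j).toNat
  refine ⟨∑ ρ, e ρ, ?_⟩
  have hmem : (∏ ρ : {ρ : Set (Fin d → ℝ) // ρ ∈ raysOf μ},
      (MvPolynomial.X ρ : MvPolynomial {ρ : Set (Fin d → ℝ) // ρ ∈ raysOf μ} ℂ) ^ e ρ) ∈
      (Ideal.span {f : MvPolynomial {ρ : Set (Fin d → ℝ) // ρ ∈ raysOf μ} ℂ |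
        ∃ m : Fin d → ℤ,
          (∀ x ∈ μ, 0 ≤ ∑ j, (m j : ℝ) * x j) ∧
          (∃ ρ : {ρ : Set (Fin d → ℝ) // ρ ∈ raysOf μ},
            (ρ : Set (Fin d → ℝ)) ⊆ σ ∧ 0 < ∑ j, m j * b ρ j) ∧
          f = ∏ᶠ ρ : {ρ : Set (Fin d → ℝ) // ρ ∈ raysOf μ},
                MvPolynomial.X ρ ^ (∑ j, m j * b ρ j).toNat}) := by
    apply Ideal.subset_span
    refine ⟨m, fun x hx => (hm x hx).1, ⟨⟨ρ, hρ⟩, hρσ, ?_⟩, ?_⟩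
    · have h1 := hm _ (hbμ ⟨ρ, hρ⟩)
      have h2 : u (fun j => ((b ⟨ρ, hρ⟩ j : ℝ))) ≠ 0 := by
        apply hρu _ (hb ⟨ρ, hρ⟩).1
        intro h
        apply (hb ⟨ρ, hρ⟩).2
        funext j
        have := congrFun h j
        simpa using this
      have h3 := lt_of_le_of_ne h1.1 (fun h => h2 (h1.2.1 h.symm))
      exact_mod_cast h3
    · rw [finprod_eq_prod_of_fintype]
  refine Ideal.mem_of_dvd _ ?_ hmem
  rw [finprod_eq_prod_of_fintype, ← Finset.prod_pow]
  apply Finset.prod_dvd_prod_of_dvd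
  intro ρ' _
  by_cases h : (ρ' : Set (Fin d → ℝ)) ⊆ {x ∈ μ | u x = 0}
  · have h0 : e ρ' = 0 := by
      have h1 := (hm _ (hbμ ρ')).2.2 (h (hb ρ').1).2
      have h2 : ∑ j, m j * b ρ' j = 0 := by exact_mod_cast h1
      simp [e, h2]
    rw [h0, pow_zero]
    exact one_dvd _
  · rw [finprod_eq_if, if_pos h]
    exact pow_dvd_pow _ (Finset.single_le_sum (f := e) (fun _ _ => Nat.zero_le _) (Finset.mem_univ ρ'))
end
end

section
/- Let Σ be a fan in ℝ^d with overall ray set Σ(1), let σ ∈ Σ, and let μ', μ ∈ Σ be cones containing σ with μ' ⊆ μ (so that μ' is a face of μ). For a cone ν ∈ Σ containing σ, define Ĩ_{ν,σ} to be the ideal of the polynomial ring ℂ[x_ρ : ρ ∈ Σ(1)] generated by the monomials x^{τ̂}_ν = ∏_{ρ∈ν(1)∖τ(1)} x_ρ, where τ ranges over the proper faces of ν that do not contain σ. Then Ĩ_{μ,σ} ⊆ Ĩ_{μ',σ}. -/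
open scoped BigOperators

noncomputable section

/-- The ideal `Ĩ_{ν,σ}` of `ℂ[x_ρ : ρ ∈ Σ(1)]` generated by the monomials
`x^{τ̂}_ν = ∏_{ρ ∈ ν(1)∖τ(1)} x_ρ` for `τ` a proper face of `ν` not containing `σ`. -/
def Itilde {d : ℕ} (F : Set (Set (Fin d → ℝ))) (ν σ : Set (Fin d → ℝ)) :
    Ideal (MvPolynomial {ρ : Set (Fin d → ℝ) // ρ ∈ fanRays F} ℂ) :=
  Ideal.span {f | ∃ τ, IsFaceOf ν τ ∧ τ ≠ ν ∧ ¬ σ ⊆ τ ∧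
    f = ∏ᶠ (ρ : {ρ : Set (Fin d → ℝ) // ρ ∈ fanRays F})
          (_ : (ρ : Set (Fin d → ℝ)) ⊆ ν ∧ ¬ (ρ : Set (Fin d → ℝ)) ⊆ τ),
        MvPolynomial.X ρ}

/-- If `σ ⊆ μ' ⊆ μ` are cones of a fan `F`, then `Ĩ_{μ,σ} ⊆ Ĩ_{μ',σ}`. -/
theorem stmt11 {d : ℕ} (F : Set (Set (Fin d → ℝ))) (hF : IsFan F)
    (σ μ μ' : Set (Fin d → ℝ)) (hσ : σ ∈ F) (hμ : μ ∈ F) (hμ' : μ' ∈ F)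
    (hσμ' : σ ⊆ μ') (hμ'μ : μ' ⊆ μ) :
    Itilde F μ σ ≤ Itilde F μ' σ := by
  have hfin : (fanRays F).Finite := by
    refine hF.1.subset ?_
    rintro ρ ⟨ν, hν, hρ⟩
    exact hF.2.2.1 ν hν ρ hρ.1
  have : Finite {ρ : Set (Fin d → ℝ) // ρ ∈ fanRays F} := hfin.to_subtype
  have := Fintype.ofFinite {ρ : Set (Fin d → ℝ) // ρ ∈ fanRays F}
  classical
  unfold Itilde
  rw [Ideal.span_le]
  rintro f ⟨τ, ⟨u, hu, hτ⟩, hne, hστ, rfl⟩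
  have hsub : ∀ x, x ∈ μ' → (x ∈ τ ↔ u x = 0) := by
    intro x hx
    rw [hτ]
    exact ⟨fun h => h.2, fun h => ⟨hμ'μ hx, h⟩⟩
  have hτ' : ¬ σ ⊆ {x ∈ μ' | u x = 0} := fun h =>
    hστ fun x hx => (hsub x (hσμ' hx)).2 (h hx).2
  refine Ideal.mem_of_dvd _ ?_ (Ideal.subset_span
    ⟨{x ∈ μ' | u x = 0}, ⟨u, fun x hx => hu x (hμ'μ hx), rfl⟩, ?_, hτ', rfl⟩)
  · simp only [finprod_eq_prod_of_fintype, finprod_eq_if]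
    rw [← Finset.prod_filter, ← Finset.prod_filter]
    apply Finset.prod_dvd_prod_of_subset
    intro ρ hρ
    simp only [Finset.mem_filter, Finset.mem_univ, true_and] at hρ ⊢
    exact ⟨hρ.1.trans hμ'μ, fun h => hρ.2 fun x hx =>
      ⟨hρ.1 hx, (hsub x (hρ.1 hx)).1 (h hx)⟩⟩
  · intro h
    exact hτ' (hσμ'.trans h.symm.subset)
end
end
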